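/- arXiv:1204.4111 — 4 statements merged into one kernel-verified Lean document; each statement's English description precedes it below -/
import Mathlib

section
/- For every non-matroid antichain 𝒮 on a finite set E, there exists a two-player weighted resource buying game with marginally non-increasing cost functions whose two strategy spaces are both isomorphic to 𝒮 and which possesses no pure Nash equilibrium. Precisely: there exist a finite resource set Ẽ, two injections φ_1, φ_2 : E → Ẽ, demands d_1, d_2 > 0, and for each e ∈ Ẽ a nondecreasing, marginally non-increasing cost function c_e : ℝ_{≥0} → ℝ_{≥0} with c_e(0) = 0, such that the two-player weighted resource buying game on Ẽ with configuration families 𝒮_1 = {φ_1(X) : X ∈ 𝒮} and 𝒮_2 = {φ_2(X) : X ∈ 𝒮} admits no pure Nash equilibrium. -/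
open Finset

noncomputable section

variable {ι E : Type*}

/-- Load of resource `e` under configuration profile `S` with demands `d`. -/
def loadOf [Fintype ι] [DecidableEq E] (d : ι → ℝ) (S : ι → Finset E) (e : E) : ℝ :=
  ∑ i ∈ Finset.univ.filter (fun i => e ∈ S i), d i

/-- Resource `e` is bought under the strategy profile `(S, p)`. -/
def Bought [Fintype ι] [DecidableEq E] (d : ι → ℝ) (c : E → ℝ → ℝ)
    (S : ι → Finset E) (p : ι → E → ℝ) (e : E) : Prop :=
  c e (loadOf d S e) ≤ ∑ i, p i e

open scoped Classical in
/-- Private cost of player `i` under strategy profile `(S, p)`: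
the total payment of `i` if all resources of `S i` are bought, and `⊤` otherwise. -/
def privCost [Fintype ι] [Fintype E] [DecidableEq E] (d : ι → ℝ) (c : E → ℝ → ℝ)
    (S : ι → Finset E) (p : ι → E → ℝ) (i : ι) : EReal :=
  if ∀ e ∈ S i, Bought d c S p e then ((∑ e, p i e : ℝ) : EReal) else ⊤

/-- `(S, p)` is a pure Nash equilibrium of the weighted resource buying game with
configuration families `conf`, demands `d` and cost functions `c`. -/
def IsPNE [Fintype ι] [Fintype E] [DecidableEq ι] [DecidableEq E]
    (conf : ι → Set (Finset E)) (d : ι → ℝ) (c : E → ℝ → ℝ)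
    (S : ι → Finset E) (p : ι → E → ℝ) : Prop :=
  (∀ i, S i ∈ conf i) ∧ (∀ i e, 0 ≤ p i e) ∧
  ∀ i (S' : Finset E) (p' : E → ℝ), S' ∈ conf i → (∀ e, 0 ≤ p' e) →
    privCost d c S p i ≤ privCost d c (Function.update S i S') (Function.update p i p') i

/-- `c` is nondecreasing (as a cost function on nonnegative reals). -/
def NondecrOn (c : ℝ → ℝ) : Prop := ∀ x y : ℝ, 0 ≤ x → x ≤ y → c x ≤ c y

/-- `c` is nonnegative (as a cost function on nonnegative reals). -/
def NonnegOn (c : ℝ → ℝ) : Prop := ∀ x : ℝ, 0 ≤ x → 0 ≤ c x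

/-- `c` has non-increasing marginal costs. -/
def MargNonincr (c : ℝ → ℝ) : Prop :=
  ∀ x y δ : ℝ, 0 ≤ x → x ≤ y → 0 ≤ δ → c (y + δ) - c y ≤ c (x + δ) - c x

/-- `c` has non-decreasing marginal costs. -/
def MargNondecr (c : ℝ → ℝ) : Prop :=
  ∀ x y δ : ℝ, 0 ≤ x → x ≤ y → 0 ≤ δ → c (x + δ) - c x ≤ c (y + δ) - c y

/-- Social cost of a configuration profile. -/
def socCost [Fintype ι] [Fintype E] [DecidableEq E] (d : ι → ℝ) (c : E → ℝ → ℝ)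
    (S : ι → Finset E) : ℝ :=
  ∑ e, c e (loadOf d S e)


/-- `𝒮` is an antichain of nonempty subsets of `E`. -/
def IsAntichainFam {E : Type*} (𝒮 : Set (Finset E)) : Prop :=
  (∀ X ∈ 𝒮, X.Nonempty) ∧ ∀ X ∈ 𝒮, ∀ Y ∈ 𝒮, X ⊆ Y → X = Y

/-- `𝒮` violates the matroid basis exchange property: there are `X, Y ∈ 𝒮` and
`x ∈ X \ Y` such that `(X \ {x}) ∪ {y} ∉ 𝒮` for every `y ∈ Y \ X`. -/
def NonMatroidFam {E : Type*} [DecidableEq E] (𝒮 : Set (Finset E)) : Prop :=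
  ∃ X ∈ 𝒮, ∃ Y ∈ 𝒮, ∃ x ∈ X, x ∉ Y ∧ ∀ y ∈ Y, y ∉ X → insert y (X.erase x) ∉ 𝒮

/-- A cost function charging the fixed amount `K` as soon as the load is positive. -/
def fixedCost (K t : ℝ) : ℝ := if t ≤ 0 then 0 else K

lemma fixedCost_le {K : ℝ} (hK : 0 ≤ K) (t : ℝ) : fixedCost K t ≤ K := by
  unfold fixedCost; split_ifs <;> linarith

lemma fixedCost_of_pos {K t : ℝ} (ht : 0 < t) : fixedCost K t = K := by
  simp [fixedCost, not_le.mpr ht]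

lemma nondecrOn_fixedCost {K : ℝ} (hK : 0 ≤ K) : NondecrOn (fixedCost K) := by
  intro x y hx hxy
  unfold fixedCost; split_ifs <;> linarith

lemma nonnegOn_fixedCost {K : ℝ} (hK : 0 ≤ K) : NonnegOn (fixedCost K) := by
  intro x hx
  unfold fixedCost; split_ifs <;> linarith

lemma margNonincr_fixedCost {K : ℝ} (hK : 0 ≤ K) : MargNonincr (fixedCost K) := by
  intro x y δ hx hxy hδ
  unfold fixedCost; split_ifs <;> linarith

/-- A non-matroid antichain contains a one-against-two exchange: within some ground set `U`,
every member uses `a` or both of `b` and `c`, and both alternatives occur. -/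
lemma exists_one_two_exchange {E : Type*} [Fintype E] [DecidableEq E] {𝒮 : Set (Finset E)}
    (hac : IsAntichainFam 𝒮) (hnm : NonMatroidFam 𝒮) :
    ∃ (a b c : E) (U : Finset E), a ≠ b ∧ a ≠ c ∧ b ≠ c ∧
      (∀ T ∈ 𝒮, T ⊆ U → a ∈ T ∨ b ∈ T ∧ c ∈ T) ∧
      (∃ W ∈ 𝒮, W ⊆ U ∧ b ∉ W ∧ c ∉ W) ∧ ∃ W ∈ 𝒮, W ⊆ U ∧ a ∉ W := by
  obtain ⟨X, hX, Y, hY, x, hxX, hxY, hexch⟩ := hnm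
  obtain ⟨Z, ⟨hZ, hZU, hxZ⟩, hmin⟩ := Set.exists_min_image
    {Z : Finset E | Z ∈ 𝒮 ∧ Z ⊆ X ∪ Y ∧ x ∉ Z} (fun Z => (Z \ X).card) (Set.toFinite _)
    ⟨Y, hY, subset_union_right, hxY⟩
  by_cases hcard : 1 < (Z \ X).card
  · obtain ⟨b, hb, c, hc, hbc⟩ := Finset.one_lt_card.mp hcard
    rw [mem_sdiff] at hb hc
    refine ⟨x, b, c, X ∪ Z, by grind, by grind, hbc, ?_,
      ⟨X, hX, subset_union_left, hb.2, hc.2⟩, ⟨Z, hZ, subset_union_right, hxZ⟩⟩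
    intro T hT hTU
    by_cases hxT : x ∈ T
    · exact Or.inl hxT
    have hsub : T \ X ⊆ Z \ X := by grind
    have heq := Finset.eq_of_subset_of_card_le hsub (hmin T ⟨hT, by grind, hxT⟩)
    right
    constructor
    · have : b ∈ T \ X := by rw [heq]; exact mem_sdiff.mpr hb
      exact (mem_sdiff.mp this).1
    · have : c ∈ T \ X := by rw [heq]; exact mem_sdiff.mpr hc
      exact (mem_sdiff.mp this).1
  · have hne : (Z \ X).card ≠ 0 := by
      rw [Finset.card_ne_zero, Finset.sdiff_nonempty]
      intro h
      exact hxZ (hac.2 Z hZ X hX h ▸ hxX)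
    obtain ⟨y, hy⟩ := Finset.card_eq_one.mp (show (Z \ X).card = 1 by omega)
    have hyZ : y ∈ Z ∧ y ∉ X := by rw [← mem_sdiff, hy]; simp
    have hZsub : Z ⊆ insert y (X.erase x) := by
      intro e he
      by_cases heX : e ∈ X
      · grind
      · have : e ∈ Z \ X := mem_sdiff.mpr ⟨he, heX⟩
        rw [hy] at this
        grind
    have hnot : ¬ insert y (X.erase x) ⊆ Z := by
      intro h
      have heq := hZsub.antisymm h
      have hyY : y ∈ Y := by
        have := hZU hyZ.1
        grind
      exact hexch y hyY hyZ.2 (heq ▸ hZ)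
    obtain ⟨b, hb, hbZ⟩ := Finset.not_subset.mp hnot
    have hbX : b ∈ X ∧ b ≠ x := by grind
    refine ⟨y, b, x, X ∪ Z, by grind, by grind, hbX.2, ?_,
      ⟨Z, hZ, subset_union_right, hbZ, hxZ⟩, ⟨X, hX, subset_union_left, hyZ.2⟩⟩
    intro T hT hTU
    by_cases hyT : y ∈ T
    · exact Or.inl hyT
    have hTX : T ⊆ X := by
      intro e he
      by_contra heX
      have : e ∈ Z \ X := mem_sdiff.mpr ⟨by grind, heX⟩
      rw [hy] at this
      grind
    have := hac.2 T hT X hX hTX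
    exact Or.inr ⟨this ▸ hbX.1, this ▸ hxX⟩

/-- In an equilibrium every used resource is bought, and no feasible deviation is cheaper. -/
lemma IsPNE.bought_and_sum_le {V : Type*} [Fintype V] [DecidableEq V]
    {conf : Fin 2 → Set (Finset V)} {d : Fin 2 → ℝ} {c : V → ℝ → ℝ}
    {S : Fin 2 → Finset V} {p : Fin 2 → V → ℝ} (h : IsPNE conf d c S p) (i : Fin 2)
    {S' : Finset V} {q : V → ℝ} (hS' : S' ∈ conf i) (hq : ∀ e, 0 ≤ q e)
    (hb : ∀ e ∈ S', Bought d c (Function.update S i S') (Function.update p i q) e) :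
    (∀ e ∈ S i, Bought d c S p e) ∧ ∑ e, p i e ≤ ∑ e, q e := by
  have hle := h.2.2 i S' q hS' hq
  unfold privCost at hle
  rw [if_pos (show ∀ e ∈ Function.update S i S' i, _ by simpa using hb)] at hle
  simp only [Function.update_self] at hle
  split_ifs at hle with hbought
  · exact ⟨hbought, by exact_mod_cast hle⟩
  · exact absurd hle (not_le.mpr (EReal.coe_lt_top _))

lemma loadOf_fin_two {V : Type*} [DecidableEq V] (d : Fin 2 → ℝ) (S : Fin 2 → Finset V) (e : V) :
    loadOf d S e = (if e ∈ S 0 then d 0 else 0) + (if e ∈ S 1 then d 1 else 0) := by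
  simp [loadOf, Finset.sum_filter, Fin.sum_univ_two]

/-- The cost functions of the counterexample: `x` is linear, `y` and `z` have fixed costs,
the remaining resources of `U` are free, and those outside `U` are prohibitively expensive. -/
def exchangeCost {V : Type*} [DecidableEq V] (x y z : V) (U : Finset V) (e : V) : ℝ → ℝ :=
  if e = x then fun t => 4 * t else
    fixedCost (if e = y then 6 else if e = z then 7 else if e ∈ U then 0 else 100)

lemma exchangeCost_admissible {V : Type*} [DecidableEq V] (x y z : V) (U : Finset V) (e : V) :
    NondecrOn (exchangeCost x y z U e) ∧ exchangeCost x y z U e 0 = 0 ∧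
      NonnegOn (exchangeCost x y z U e) ∧ MargNonincr (exchangeCost x y z U e) := by
  unfold exchangeCost
  split_ifs
  · refine ⟨?_, by simp, ?_, ?_⟩
    · intro s t hs hst
      dsimp only
      linarith
    · intro s hs
      dsimp only
      linarith
    · intro s t δ hs hst hδ
      dsimp only
      linarith
  all_goals
    exact ⟨nondecrOn_fixedCost (by norm_num), by simp [fixedCost],
      nonnegOn_fixedCost (by norm_num), margNonincr_fixedCost (by norm_num)⟩

/-- The two-player game in which player `0` needs `x` or both `y` and `z`, and player `1` needs
`y` or both `x` and `z`, has no pure Nash equilibrium for demands `2` and `1`. -/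
lemma not_isPNE_exchangeCost {V : Type*} [Fintype V] [DecidableEq V] {x y z : V} {U : Finset V}
    (hxy : x ≠ y) (hxz : x ≠ z) (hyz : y ≠ z) {conf : Fin 2 → Set (Finset V)}
    (h₀ : ∀ T ∈ conf 0, T ⊆ U → x ∈ T ∨ y ∈ T ∧ z ∈ T)
    (hx₀ : ∃ W ∈ conf 0, W ⊆ U ∧ y ∉ W ∧ z ∉ W) (hyz₀ : ∃ W ∈ conf 0, W ⊆ U ∧ x ∉ W)
    (h₁ : ∀ T ∈ conf 1, T ⊆ U → y ∈ T ∨ x ∈ T ∧ z ∈ T)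
    (hy₁ : ∃ W ∈ conf 1, W ⊆ U ∧ x ∉ W ∧ z ∉ W) (hxz₁ : ∃ W ∈ conf 1, W ⊆ U ∧ y ∉ W)
    (S : Fin 2 → Finset V) (p : Fin 2 → V → ℝ) :
    ¬ IsPNE conf ![2, 1] (exchangeCost x y z U) S p := by
  intro h
  have hp := h.2.1
  have cost_x (t : ℝ) : exchangeCost x y z U x t = 4 * t := by simp [exchangeCost]
  have cost_y (t : ℝ) : exchangeCost x y z U y t = fixedCost 6 t := by
    simp [exchangeCost, hxy.symm]
  have cost_z (t : ℝ) : exchangeCost x y z U z t = fixedCost 7 t := by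
    simp [exchangeCost, hxz.symm, hyz.symm]
  have cost_free (e : V) (he : e ∈ U) (hex : e ≠ x) (hey : e ≠ y) (hez : e ≠ z) (t : ℝ) :
      exchangeCost x y z U e t = 0 := by
    simp [exchangeCost, fixedCost, hex, hey, hez, he]
  have hy_le (t : ℝ) := fixedCost_le (show (0 : ℝ) ≤ 6 by norm_num) t
  have hz_le (t : ℝ) := fixedCost_le (show (0 : ℝ) ≤ 7 by norm_num) t
  have sum_two (u v : V) (r s : ℝ) :
      ∑ e, ((if e = u then r else 0) + (if e = v then s else 0)) = r + s := by
    simp [Finset.sum_add_distrib]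
  have dev₀x : (∀ e ∈ S 0, Bought ![2, 1] (exchangeCost x y z U) S p e) ∧
      ∑ e, p 0 e ≤ max 0 (4 * (2 + if x ∈ S 1 then 1 else 0) - p 1 x) := by
    obtain ⟨W, hW, hWU, hyW, hzW⟩ := hx₀
    have := h.bought_and_sum_le 0 (q := fun e =>
      if e = x then max 0 (4 * (2 + if x ∈ S 1 then 1 else 0) - p 1 x) else 0) hW
      (fun e => by positivity) ?_
    · simpa using this
    intro e he
    simp only [Bought, loadOf_fin_two, Fin.sum_univ_two, Function.update_self]
    by_cases hex : e = x
    · subst hex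
      have := le_max_right 0 (4 * (2 + if e ∈ S 1 then 1 else 0) - p 1 e)
      simp [cost_x, he] at this ⊢
      grind
    · rw [cost_free e (hWU he) hex (by grind) (by grind)]
      simpa [hex] using hp 1 e
  have dev₀yz : ∑ e, p 0 e ≤ max 0 (6 - p 1 y) + max 0 (7 - p 1 z) := by
    obtain ⟨W, hW, hWU, hxW⟩ := hyz₀
    have := h.bought_and_sum_le 0 (q := fun e =>
      (if e = y then max 0 (6 - p 1 y) else 0) + (if e = z then max 0 (7 - p 1 z) else 0)) hW
      (fun e => by positivity) ?_
    · simpa only [sum_two] using this.2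
    intro e he
    simp only [Bought, Fin.sum_univ_two, Function.update_self]
    by_cases hey : e = y
    · subst hey
      rw [cost_y]
      have := le_max_right 0 (6 - p 1 e)
      simp [hyz] at this ⊢
      grind
    by_cases hez : e = z
    · subst hez
      rw [cost_z]
      have := le_max_right 0 (7 - p 1 e)
      simp [hyz.symm] at this ⊢
      grind
    rw [cost_free e (hWU he) (by grind) hey hez]
    simpa [hey, hez] using hp 1 e
  have dev₁y : (∀ e ∈ S 1, Bought ![2, 1] (exchangeCost x y z U) S p e) ∧
      ∑ e, p 1 e ≤ max 0 (6 - p 0 y) := by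
    obtain ⟨W, hW, hWU, hxW, hzW⟩ := hy₁
    have := h.bought_and_sum_le 1 (q := fun e => if e = y then max 0 (6 - p 0 y) else 0) hW
      (fun e => by positivity) ?_
    · simpa using this
    intro e he
    simp only [Bought, Fin.sum_univ_two, Function.update_self]
    by_cases hey : e = y
    · subst hey
      rw [cost_y]
      have := le_max_right 0 (6 - p 0 e)
      simp at this ⊢
      grind
    · rw [cost_free e (hWU he) (by grind) hey (by grind)]
      simpa [hey] using hp 0 e
  have dev₁xz : ∑ e, p 1 e ≤
      max 0 (4 * (1 + if x ∈ S 0 then 2 else 0) - p 0 x) + max 0 (7 - p 0 z) := by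
    obtain ⟨W, hW, hWU, hyW⟩ := hxz₁
    have := h.bought_and_sum_le 1 (q := fun e =>
      (if e = x then max 0 (4 * (1 + if x ∈ S 0 then 2 else 0) - p 0 x) else 0) +
        (if e = z then max 0 (7 - p 0 z) else 0)) hW
      (fun e => by positivity) ?_
    · simpa only [sum_two] using this.2
    intro e he
    simp only [Bought, loadOf_fin_two, Fin.sum_univ_two, Function.update_self]
    by_cases hex : e = x
    · subst hex
      have := le_max_right 0 (4 * (1 + if e ∈ S 0 then 2 else 0) - p 0 e)
      simp [cost_x, he, hxz] at this ⊢
      grind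
    by_cases hez : e = z
    · subst hez
      rw [cost_z]
      have := le_max_right 0 (7 - p 0 e)
      simp [hxz.symm] at this ⊢
      grind
    rw [cost_free e (hWU he) hex (by grind) hez]
    simpa [hex, hez] using hp 0 e
  obtain ⟨bought₀, dev₀x⟩ := dev₀x
  obtain ⟨bought₁, dev₁y⟩ := dev₁y
  have single_le (i : Fin 2) (e : V) : p i e ≤ ∑ e, p i e :=
    Finset.single_le_sum (fun e _ => hp i e) (mem_univ e)
  have triple_le (i : Fin 2) : p i x + p i y + p i z ≤ ∑ e, p i e := by
    have := Finset.sum_le_sum_of_subset_of_nonneg (f := p i) (subset_univ {x, y, z})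
      (fun e _ _ => hp i e)
    rw [sum_insert (by simp [hxy, hxz]), sum_pair hyz] at this
    linarith
  have load_pos (e : V) (he : e ∈ S 0 ∨ e ∈ S 1) : 0 < loadOf ![2, 1] S e := by
    rw [loadOf_fin_two]
    simp only [Matrix.cons_val_zero, Matrix.cons_val_one]
    rcases he with he | he <;> simp only [he, if_true] <;> split_ifs <;> norm_num
  have bought (e : V) (he : e ∈ S 0 ∨ e ∈ S 1) :
      exchangeCost x y z U e (loadOf ![2, 1] S e) ≤ p 0 e + p 1 e := by
    have := he.elim (bought₀ e) (bought₁ e)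
    simpa only [Bought, Fin.sum_univ_two] using this
  have hxb : 0 ≤ p 0 x ∧ 0 ≤ p 1 x := ⟨hp _ _, hp _ _⟩
  have hyb : 0 ≤ p 0 y ∧ 0 ≤ p 1 y := ⟨hp _ _, hp _ _⟩
  have hzb : 0 ≤ p 0 z ∧ 0 ≤ p 1 z := ⟨hp _ _, hp _ _⟩
  have total₀ : ∑ e, p 0 e ≤ 12 := by
    refine dev₀x.trans (max_le (by norm_num) ?_)
    split_ifs <;> linarith
  have total₁ : ∑ e, p 1 e ≤ 6 := dev₁y.trans (max_le (by norm_num) (by linarith))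
  have hxU : x ∈ U := by
    obtain ⟨W, hW, hWU, hyW, hzW⟩ := hx₀
    exact hWU ((h₀ W hW hWU).resolve_right fun hw => hyW hw.1)
  have hyzU : y ∈ U ∧ z ∈ U := by
    obtain ⟨W, hW, hWU, hxW⟩ := hyz₀
    exact ((h₀ W hW hWU).resolve_left hxW).imp (hWU ·) (hWU ·)
  have subset_U (e : V) (he : e ∈ S 0 ∨ e ∈ S 1) : e ∈ U := by
    by_contra heU
    have hex : e ≠ x := fun heq => heU (heq ▸ hxU)
    have hey : e ≠ y := fun heq => heU (heq ▸ hyzU.1)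
    have hez : e ≠ z := fun heq => heU (heq ▸ hyzU.2)
    have hb := bought e he
    simp only [exchangeCost, hex, hey, hez, heU, if_false, fixedCost_of_pos (load_pos e he)] at hb
    have := single_le 0 e
    have := single_le 1 e
    linarith
  have use₀ := h₀ (S 0) (h.1 0) fun e he => subset_U e (Or.inl he)
  have use₁ := h₁ (S 1) (h.1 1) fun e he => subset_U e (Or.inr he)
  have bought_x (hx : x ∈ S 0 ∨ x ∈ S 1) :
      4 * ((if x ∈ S 0 then 2 else 0) + if x ∈ S 1 then 1 else 0) ≤ p 0 x + p 1 x := by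
    simpa [cost_x, loadOf_fin_two] using bought x hx
  have bought_y (hy : y ∈ S 0 ∨ y ∈ S 1) : 6 ≤ p 0 y + p 1 y := by
    have := bought y hy
    rwa [cost_y, fixedCost_of_pos (load_pos y hy)] at this
  have bought_z (hz : z ∈ S 0 ∨ z ∈ S 1) : 7 ≤ p 0 z + p 1 z := by
    have := bought z hz
    rwa [cost_z, fixedCost_of_pos (load_pos z hz)] at this
  have t₀ := triple_le 0
  have t₁ := triple_le 1
  by_cases hx : x ∈ S 0
  · have hbx := bought_x (Or.inl hx)
    rw [if_pos hx] at hbx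
    have own : ∑ e, p 0 e ≤ p 0 x := dev₀x.trans (max_le hxb.1 (by linarith))
    by_cases hy : y ∈ S 1
    · have hby := bought_y (Or.inr hy)
      have := dev₁y.trans (max_le hyb.2 (by linarith))
      have hsix : max 0 (6 - p 1 y) ≤ 0 := max_le le_rfl (by linarith)
      have hseven : max 0 (7 - p 1 z) ≤ 7 := max_le (by norm_num) (by linarith)
      split_ifs at hbx <;> linarith
    · have := bought_z (Or.inr (use₁.resolve_left hy).2)
      linarith
  · have hyz₀ := use₀.resolve_left hx
    have hby := bought_y (Or.inl hyz₀.1)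
    have hbz := bought_z (Or.inl hyz₀.2)
    have own : ∑ e, p 0 e ≤ p 0 y + p 0 z := dev₀yz.trans
      (add_le_add (max_le hyb.1 (by linarith)) (max_le hzb.1 (by linarith)))
    have hpay_x : x ∈ S 1 → 4 ≤ p 1 x := fun hx₁ => by
      have := bought_x (Or.inr hx₁)
      rw [if_neg hx, if_pos hx₁] at this
      linarith
    by_cases hy : y ∈ S 1
    · have own₁ := dev₁y.trans (max_le hyb.2 (by linarith))
      have hx₁ : x ∉ S 1 := fun hx₁ => by linarith [hpay_x hx₁]
      rw [if_neg hx₁] at dev₀x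
      rw [if_neg hx] at dev₁xz
      have hfour : max 0 (4 * (1 + 0) - p 0 x) ≤ 4 := max_le (by norm_num) (by linarith)
      have hzero : max 0 (7 - p 0 z) ≤ 0 := max_le le_rfl (by linarith)
      have height : max 0 (4 * (2 + 0) - p 1 x) ≤ 8 := max_le (by norm_num) (by linarith)
      linarith
    · have hxz₁ := use₁.resolve_left hy
      rw [if_neg hx] at dev₁xz
      have := hpay_x hxz₁.1
      have own₁ : ∑ e, p 1 e ≤ p 1 x + p 1 z := dev₁xz.trans
        (add_le_add (max_le hxb.2 (by linarith)) (max_le hzb.2 (by linarith)))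
      have hzero : max 0 (6 - p 0 y) ≤ 0 := max_le le_rfl (by linarith)
      linarith

/-- For every non-matroid antichain `𝒮` on a finite set `E`, there is
a two-player weighted resource buying game with nondecreasing, normalized, marginally
non-increasing cost functions whose two strategy spaces are both isomorphic to `𝒮`
(via injections `φ₁, φ₂` into a resource set `Ẽ`) and which has no pure Nash
equilibrium. -/
theorem statement4 {E : Type*} [Fintype E] [DecidableEq E] (𝒮 : Set (Finset E))
    (hac : IsAntichainFam 𝒮) (hnm : NonMatroidFam 𝒮) :
    ∃ (Et : Type) (_ : Fintype Et) (_ : DecidableEq Et)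
      (φ₁ φ₂ : E → Et) (d : Fin 2 → ℝ) (c : Et → ℝ → ℝ),
      Function.Injective φ₁ ∧ Function.Injective φ₂ ∧
      (∀ i, 0 < d i) ∧
      (∀ e, NondecrOn (c e)) ∧ (∀ e, c e 0 = 0) ∧ (∀ e, NonnegOn (c e)) ∧
      (∀ e, MargNonincr (c e)) ∧
      ¬ ∃ (S : Fin 2 → Finset Et) (p : Fin 2 → Et → ℝ),
          IsPNE (fun i : Fin 2 =>
              if i = 0 then (fun X : Finset E => X.image φ₁) '' 𝒮
              else (fun X : Finset E => X.image φ₂) '' 𝒮)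
            d c S p := by
  obtain ⟨a, b, c, U, hab, hac', hbc, hall, hW₁, hW₂⟩ := exists_one_two_exchange hac hnm
  have haU : a ∈ U := by
    obtain ⟨W, hW, hWU, hbW, hcW⟩ := hW₁
    exact hWU ((hall W hW hWU).resolve_right fun hw => hbW hw.1)
  have hbU : b ∈ U := by
    obtain ⟨W, hW, hWU, haW⟩ := hW₂
    exact hWU ((hall W hW hWU).resolve_left haW).1
  let f := Fintype.equivFin E
  let g := (Equiv.swap a b).trans f
  have hga : g a = f b := by simp [g]
  have hgb : g b = f a := by simp [g]
  have hgc : g c = f c := by simp [g, Equiv.swap_apply_of_ne_of_ne hac'.symm hbc.symm]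
  have hgU : U.image g = U.image f := by
    have : U.image (Equiv.swap a b) = U := by
      refine Finset.eq_of_subset_of_card_le (fun e he => ?_)
        (Finset.card_image_of_injective _ (Equiv.injective _)).ge
      obtain ⟨e', he', rfl⟩ := mem_image.mp he
      rw [Equiv.swap_apply_def]
      split_ifs <;> assumption
    rw [show (g : E → _) = f ∘ Equiv.swap a b from rfl, ← Finset.image_image, this]
  have image_sub (φ : E ≃ Fin (Fintype.card E)) (T : Finset E) :
      T.image φ ⊆ U.image φ ↔ T ⊆ U := Finset.image_subset_image_iff φ.injective
  have mem_im (φ : E ≃ Fin (Fintype.card E)) (T : Finset E) (e : E) :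
      φ e ∈ T.image φ ↔ e ∈ T := φ.injective.mem_finset_image
  refine ⟨Fin (Fintype.card E), inferInstance, inferInstance, f, g, ![2, 1],
    exchangeCost (f a) (f b) (f c) (U.image f), f.injective, g.injective, ?_,
    fun e => (exchangeCost_admissible _ _ _ _ e).1, fun e => (exchangeCost_admissible _ _ _ _ e).2.1,
    fun e => (exchangeCost_admissible _ _ _ _ e).2.2.1,
    fun e => (exchangeCost_admissible _ _ _ _ e).2.2.2, ?_⟩
  · intro i
    fin_cases i <;> simp
  rintro ⟨S, p, h⟩
  obtain ⟨W₁, hW₁, hW₁U, hbW₁, hcW₁⟩ := hW₁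
  obtain ⟨W₂, hW₂, hW₂U, haW₂⟩ := hW₂
  refine not_isPNE_exchangeCost (f.injective.ne hab) (f.injective.ne hac') (f.injective.ne hbc)
    ?_ ?_ ?_ ?_ ?_ ?_ S p h
  · rintro _ ⟨T, hT, rfl⟩ hTU
    simpa only [mem_im] using hall T hT ((image_sub f T).mp hTU)
  · refine ⟨W₁.image f, ⟨W₁, hW₁, rfl⟩, (image_sub f W₁).mpr hW₁U, ?_⟩
    simpa only [mem_im] using ⟨hbW₁, hcW₁⟩
  · refine ⟨W₂.image f, ⟨W₂, hW₂, rfl⟩, (image_sub f W₂).mpr hW₂U, ?_⟩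
    simpa only [mem_im] using haW₂
  all_goals simp only [← hga, ← hgb, ← hgc, ← hgU]
  · rintro _ ⟨T, hT, rfl⟩ hTU
    simpa only [mem_im] using hall T hT ((image_sub g T).mp hTU)
  · refine ⟨W₁.image g, ⟨W₁, hW₁, rfl⟩, (image_sub g W₁).mpr hW₁U, ?_⟩
    simpa only [mem_im] using ⟨hbW₁, hcW₁⟩
  · refine ⟨W₂.image g, ⟨W₂, hW₂, rfl⟩, (image_sub g W₂).mpr hW₂U, ?_⟩
    simpa only [mem_im] using haW₂

end
end

section
/- Let 𝒮 ⊆ 2^E be a non-matroid antichain on a finite set E. Then there exist X, Y ∈ 𝒮 and three pairwise distinct elements a, b, c ∈ X ∪ Y such that every Z ∈ 𝒮 with Z ⊆ (X ∪ Y) \ {a} contains both b and c. -/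
open Finset

noncomputable section

variable {ι E : Type*}

/-- If `𝒮` is a non-matroid antichain on a finite set `E`, then there
are `X, Y ∈ 𝒮` and three pairwise distinct elements `a, b, c ∈ X ∪ Y` such that every
`Z ∈ 𝒮` with `Z ⊆ (X ∪ Y) \ {a}` contains both `b` and `c`. -/
theorem statement5 {E : Type*} [Fintype E] [DecidableEq E] (𝒮 : Set (Finset E))
    (hac : IsAntichainFam 𝒮) (hnm : NonMatroidFam 𝒮) :
    ∃ X ∈ 𝒮, ∃ Y ∈ 𝒮, ∃ a ∈ X ∪ Y, ∃ b ∈ X ∪ Y, ∃ c ∈ X ∪ Y,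
      a ≠ b ∧ a ≠ c ∧ b ≠ c ∧
      ∀ Z ∈ 𝒮, Z ⊆ (X ∪ Y).erase a → b ∈ Z ∧ c ∈ Z := by
  obtain ⟨X, hX, Y, hY, x, hxX, hxY, hex⟩ := hnm
  obtain ⟨V, ⟨hV, hVsub⟩, hmin⟩ := exists_minimalFor_of_wellFoundedLT
    (fun Z : Finset E => Z ∈ 𝒮 ∧ Z ⊆ (X ∪ Y).erase x) (fun Z => (Z \ X).card)
    ⟨Y, hY, fun y hy => by grind⟩
  have hxV : x ∉ V := fun h => by grind
  have hne : (V \ X).Nonempty := by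
    rw [Finset.sdiff_nonempty]
    intro h
    exact hxV (hac.2 V hV X hX h ▸ hxX)
  rcases (Nat.succ_le_of_lt hne.card_pos).eq_or_lt with h1 | h2
  · -- `V` adds a single element `y` to `X` but drops at least two.
    obtain ⟨y, hy⟩ := Finset.card_eq_one.1 h1.symm
    have hyV : y ∈ V ∧ y ∉ X := by
      rw [← Finset.mem_sdiff, hy, Finset.mem_singleton]
    have hVX : ∀ z ∈ V, z ∉ X → z = y := fun z hz hzX =>
      Finset.mem_singleton.1 (hy ▸ Finset.mem_sdiff.2 ⟨hz, hzX⟩)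
    obtain ⟨z, hzX, hzV, hzx⟩ : ∃ z ∈ X, z ∉ V ∧ z ≠ x := by
      by_contra! hall
      refine hex y (by grind) hyV.2 ?_
      convert hV using 1
      ext z
      grind
    refine ⟨X, hX, V, hV, y, by grind, x, by grind, z, by grind, by grind, by grind,
      hzx.symm, fun Z hZ hZs => ?_⟩
    have hZX : Z = X := hac.2 Z hZ X hX fun w hw => by grind
    exact hZX ▸ ⟨hxX, hzX⟩
  · -- Every competitor avoiding `x` contains all of `V \ X`, by minimality.
    obtain ⟨b, hb, c, hc, hbc⟩ := Finset.one_lt_card.1 h2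
    rw [Finset.mem_sdiff] at hb hc
    refine ⟨X, hX, V, hV, x, by grind, b, by grind, c, by grind, by grind, by grind, hbc,
      fun Z hZ hZs => ?_⟩
    have hsub : Z \ X ⊆ V \ X := fun w hw => by grind
    have hle : (V \ X).card ≤ (Z \ X).card :=
      hmin ⟨hZ, fun w hw => by grind⟩ (Finset.card_le_card hsub)
    have heq := Finset.eq_of_subset_of_card_le hsub hle
    exact ⟨(Finset.mem_sdiff.1 (heq ▸ Finset.mem_sdiff.2 hb)).1,
      (Finset.mem_sdiff.1 (heq ▸ Finset.mem_sdiff.2 hc)).1⟩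

end
end

section
/- Let S* be a socially optimal configuration profile of a weighted resource buying game all of whose cost functions are marginally non-decreasing, and let p be the marginal cost pricing payment vector associated with S* and a fixed order 1,…,n of the players. Then the strategy profile (S*, p) is a pure Nash equilibrium. -/
open Finset

noncomputable section

variable {ι E : Type*}

/-- `ℓ_e^{≤ i}(S)`: the load on `e` from players `j ≤ i` using `e`. -/
def loadUpto {n : ℕ} [DecidableEq E] (d : Fin n → ℝ) (S : Fin n → Finset E)
    (e : E) (i : Fin n) : ℝ :=
  ∑ j ∈ Finset.univ.filter (fun j => j ≤ i ∧ e ∈ S j), d j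

/-- `ℓ_e^{< i}(S)` (that is, `ℓ_e^{≤ i-1}(S)`): the load on `e` from players `j < i`
using `e`. -/
def loadBelow {n : ℕ} [DecidableEq E] (d : Fin n → ℝ) (S : Fin n → Finset E)
    (e : E) (i : Fin n) : ℝ :=
  ∑ j ∈ Finset.univ.filter (fun j => j < i ∧ e ∈ S j), d j

/-- Marginal cost pricing with respect to the profile `S` and the natural order of the
players `1, …, n`. -/
def mcPricing {n : ℕ} [Fintype E] [DecidableEq E] (c : E → ℝ → ℝ) (d : Fin n → ℝ)
    (S : Fin n → Finset E) : Fin n → E → ℝ :=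
  fun i e => if e ∈ S i then c e (loadUpto d S e i) - c e (loadBelow d S e i) else 0

section MarginalCostPricing

variable {n : ℕ} [DecidableEq E] (d : Fin n → ℝ) (S : Fin n → Finset E) (e : E) (i : Fin n)

theorem loadBelow_nonneg (hd : ∀ i, 0 < d i) : 0 ≤ loadBelow d S e i :=
  Finset.sum_nonneg fun j _ => (hd j).le

theorem loadUpto_eq_loadBelow_add :
    loadUpto d S e i = loadBelow d S e i + if e ∈ S i then d i else 0 := by
  simp only [loadUpto, loadBelow, Finset.sum_filter]
  rw [← Fintype.sum_ite_eq i (fun _ => if e ∈ S i then d i else 0), ← Finset.sum_add_distrib]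
  refine Finset.sum_congr rfl fun j _ => ?_
  rcases lt_trichotomy j i with h | rfl | h
  · simp [h, h.le, h.ne']
  · simp
  · simp [h.not_gt, h.not_ge, h.ne]

/-- The total marginal cost payments on a resource equal its cost. -/
theorem sum_mcPricing [Fintype E] (c : E → ℝ → ℝ) (hzero : c e 0 = 0) :
    ∑ i, mcPricing c d S i e = c e (loadOf d S e) := by
  let F : ℕ → ℝ := fun k => c e (∑ j with j.val < k ∧ e ∈ S j, d j)
  have key : ∀ i : Fin n, mcPricing c d S i e = F (i + 1) - F i := by
    intro i
    have hup : F (i + 1) = c e (loadUpto d S e i) := by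
      simp only [F, loadUpto, Nat.lt_succ_iff, Fin.le_def]
    have hbelow : F i = c e (loadBelow d S e i) := by
      simp only [F, loadBelow, Fin.lt_def]
    rw [hup, hbelow, mcPricing]
    split_ifs with h
    · rfl
    · simp [loadUpto_eq_loadBelow_add, h]
  rw [Finset.sum_congr rfl fun i _ => key i,
    Fin.sum_univ_eq_sum_range (fun k => F (k + 1) - F k), Finset.sum_range_sub]
  simp [F, hzero, loadOf]

/-- Total load on `e` from the players other than `i`. -/
def loadOthers : ℝ := ∑ j with j ≠ i ∧ e ∈ S j, d j

theorem loadOf_update (T : Finset E) :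
    loadOf d (Function.update S i T) e = loadOthers d S e i + if e ∈ T then d i else 0 := by
  simp only [loadOf, loadOthers, Finset.sum_filter]
  rw [← Fintype.sum_ite_eq i (fun _ => if e ∈ T then d i else 0), ← Finset.sum_add_distrib]
  refine Finset.sum_congr rfl fun j _ => ?_
  rcases eq_or_ne j i with rfl | h
  · simp
  · simp [h, h.symm]

theorem loadOf_eq_loadOthers_add :
    loadOf d S e = loadOthers d S e i + if e ∈ S i then d i else 0 := by
  simpa using loadOf_update d S e i (S i)

theorem loadBelow_le_loadOthers (hd : ∀ i, 0 < d i) :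
    loadBelow d S e i ≤ loadOthers d S e i := by
  refine Finset.sum_le_sum_of_subset_of_nonneg (fun j hj => ?_) fun j _ _ => (hd j).le
  simp only [Finset.mem_filter, Finset.mem_univ, true_and] at hj ⊢
  exact ⟨hj.1.ne, hj.2⟩

theorem mcPricing_nonneg [Fintype E] (hd : ∀ i, 0 < d i) (c : E → ℝ → ℝ)
    (hmono : NondecrOn (c e)) : 0 ≤ mcPricing c d S i e := by
  unfold mcPricing
  split_ifs with h
  · refine sub_nonneg.2 (hmono _ _ (loadBelow_nonneg d S e i hd) ?_)
    simp [loadUpto_eq_loadBelow_add, h, (hd i).le]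
  · exact le_rfl

/-- A player pays at most the marginal cost she causes when added last. -/
theorem mcPricing_le [Fintype E] (hd : ∀ i, 0 < d i) (c : E → ℝ → ℝ)
    (hMND : MargNondecr (c e)) :
    mcPricing c d S i e ≤ c e (loadOf d S e) - c e (loadOthers d S e i) := by
  rw [loadOf_eq_loadOthers_add d S e i, mcPricing, loadUpto_eq_loadBelow_add]
  split_ifs with h
  · exact hMND _ _ _ (loadBelow_nonneg d S e i hd) (loadBelow_le_loadOthers d S e i hd) (hd i).le
  · simp

/-- The saving of a deviating player on a resource is at most the decrease of its cost. -/
theorem mcPricing_sub_le [Fintype E] (hd : ∀ i, 0 < d i) (c : E → ℝ → ℝ)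
    (hzero : c e 0 = 0) (hMND : MargNondecr (c e)) (T : Finset E) (q : E → ℝ) (hq : 0 ≤ q e)
    (hbought : e ∈ T → Bought d c (Function.update S i T)
      (Function.update (mcPricing c d S) i q) e) :
    mcPricing c d S i e - q e ≤
      c e (loadOf d S e) - c e (loadOf d (Function.update S i T) e) := by
  by_cases hT : e ∈ T
  · have hb := hbought hT
    have hsum := sum_mcPricing d S e c hzero
    rw [← Finset.add_sum_erase _ _ (Finset.mem_univ i)] at hsum
    rw [Bought, ← Finset.add_sum_erase _ _ (Finset.mem_univ i), Function.update_self,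
      Finset.sum_congr rfl fun j hj => by
        rw [Function.update_of_ne (Finset.ne_of_mem_erase hj)]] at hb
    linarith
  · have hle := mcPricing_le d S e i hd c hMND
    rw [loadOf_update, if_neg hT, add_zero]
    linarith

end MarginalCostPricing

/-- If `S*` is a socially optimal configuration profile of a weighted
resource buying game with (nondecreasing, normalized) marginally non-decreasing cost
functions, then marginal cost pricing turns `S*` into a pure Nash equilibrium. -/
theorem statement6 {n : ℕ} {E : Type*} [Fintype E] [DecidableEq E]
    (conf : Fin n → Set (Finset E)) (hconf : ∀ i, (conf i).Nonempty)
    (d : Fin n → ℝ) (hd : ∀ i, 0 < d i) (c : E → ℝ → ℝ)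
    (hmono : ∀ e, NondecrOn (c e)) (hzero : ∀ e, c e 0 = 0)
    (hnonneg : ∀ e, NonnegOn (c e)) (hMND : ∀ e, MargNondecr (c e))
    (S : Fin n → Finset E) (hS : ∀ i, S i ∈ conf i)
    (hopt : ∀ S' : Fin n → Finset E, (∀ i, S' i ∈ conf i) →
      socCost d c S ≤ socCost d c S') :
    IsPNE conf d c S (mcPricing c d S) := by
  refine ⟨hS, fun i e => mcPricing_nonneg d S e i hd c (hmono e), fun i T q hT hq => ?_⟩
  have hbought : ∀ e ∈ S i, Bought d c S (mcPricing c d S) e :=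
    fun e _ => (sum_mcPricing d S e c (hzero e)).ge
  rw [privCost, if_pos hbought, privCost]
  split_ifs with hdev
  · rw [EReal.coe_le_coe_iff, Function.update_self]
    have hsocial := hopt (Function.update S i T) fun j => by
      rcases eq_or_ne j i with rfl | hj
      · simpa using hT
      · simpa [hj] using hS j
    have hsaving := Finset.sum_le_sum fun e (_ : e ∈ Finset.univ) =>
      mcPricing_sub_le d S e i hd c (hzero e) (hMND e) T q (hq e)
        fun he => hdev e (by simpa using he)
    simp only [Finset.sum_sub_distrib] at hsaving
    simp only [socCost] at hsocial
    linarith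
  · exact le_top

end
end

section
/- Every weighted resource buying game all of whose cost functions are marginally non-decreasing possesses a pure Nash equilibrium, regardless of the structure of the players' configuration families. -/
open Finset

noncomputable section

variable {ι E : Type*}

/-- The cost of the total load is at most the sum of the marginal costs of the individual loads. -/
theorem MargNondecr.sum_le [Fintype ι] {c : ℝ → ℝ} (hc : MargNondecr c) (hzero : c 0 = 0)
    {a : ι → ℝ} (ha : ∀ i, 0 ≤ a i) (T : Finset ι) :
    c (∑ i ∈ T, a i) ≤ ∑ i ∈ T, (c (∑ j, a j) - c (∑ j, a j - a i)) := by
  classical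
  induction T using Finset.induction_on with
  | empty => simp [hzero]
  | insert i T hi ih =>
    have hle : ∑ j ∈ insert i T, a j ≤ ∑ j, a j :=
      Finset.sum_le_sum_of_subset_of_nonneg (Finset.subset_univ _) fun j _ _ => ha j
    rw [Finset.sum_insert hi] at hle ⊢
    rw [Finset.sum_insert hi]
    have h := hc (∑ j ∈ T, a j) (∑ j, a j - a i) (a i)
      (Finset.sum_nonneg fun j _ => ha j) (by linarith) (ha i)
    rw [sub_add_cancel, add_comm] at h
    linarith

/-- The cost of the total load can be split so that no share exceeds the marginal cost of the
corresponding individual load. -/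
theorem MargNondecr.exists_cost_shares [Fintype ι] {c : ℝ → ℝ} (hc : MargNondecr c)
    (hmono : NondecrOn c) (hzero : c 0 = 0) {a : ι → ℝ} (ha : ∀ i, 0 ≤ a i) :
    ∃ q : ι → ℝ, (∀ i, 0 ≤ q i) ∧ ∑ i, q i = c (∑ i, a i) ∧
      ∀ i, q i ≤ c (∑ j, a j) - c (∑ j, a j - a i) := by
  set m : ι → ℝ := fun i => c (∑ j, a j) - c (∑ j, a j - a i) with hm
  have hm0 : ∀ i, 0 ≤ m i := fun i => by
    have hle : a i ≤ ∑ j, a j := Finset.single_le_sum (fun j _ => ha j) (Finset.mem_univ i)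
    have := hmono (∑ j, a j - a i) (∑ j, a j) (by linarith) (by linarith [ha i])
    simp only [hm]
    linarith
  have hc0 : 0 ≤ c (∑ j, a j) := by
    have := hmono 0 (∑ j, a j) le_rfl (Finset.sum_nonneg fun j _ => ha j)
    linarith
  have hle : c (∑ j, a j) ≤ ∑ i, m i := hc.sum_le hzero ha Finset.univ
  have hM : 0 ≤ ∑ i, m i := hc0.trans hle
  refine ⟨fun i => c (∑ j, a j) / (∑ j, m j) * m i,
    fun i => mul_nonneg (div_nonneg hc0 hM) (hm0 i), ?_,
    fun i => mul_le_of_le_one_left (hm0 i) (div_le_one_of_le₀ hle hM)⟩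
  rw [← Finset.mul_sum]
  exact div_mul_cancel_of_imp fun h => le_antisymm (hle.trans_eq h) hc0

theorem loadOf_eq_sum_ite [Fintype ι] [DecidableEq E] (d : ι → ℝ) (S : ι → Finset E) (e : E) :
    loadOf d S e = ∑ i, if e ∈ S i then d i else 0 :=
  Finset.sum_filter _ _

theorem loadOf_update_of_notMem [Fintype ι] [DecidableEq ι] [DecidableEq E] (d : ι → ℝ)
    (S : ι → Finset E) (i : ι) {S' : Finset E} {e : E} (he : e ∉ S') :
    loadOf d (Function.update S i S') e = loadOf d S e - if e ∈ S i then d i else 0 := by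
  rw [loadOf_eq_sum_ite, loadOf_eq_sum_ite, ← Finset.add_sum_erase _ _ (Finset.mem_univ i),
    ← Finset.add_sum_erase _ (fun j => if e ∈ S j then d j else 0) (Finset.mem_univ i)]
  simp only [Function.update_self, he, if_false, zero_add, add_sub_cancel_left]
  refine Finset.sum_congr rfl fun j hj => ?_
  rw [Function.update_of_ne (Finset.ne_of_mem_erase hj)]

theorem sum_update_payment [Fintype ι] [DecidableEq ι] (p : ι → E → ℝ) (i : ι) (p' : E → ℝ)
    (e : E) : ∑ j, Function.update p i p' j e = p' e + ∑ j, p j e - p i e := by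
  rw [← Finset.add_sum_erase _ _ (Finset.mem_univ i),
    ← Finset.add_sum_erase _ (fun j => p j e) (Finset.mem_univ i), Function.update_self,
    Finset.sum_congr rfl fun j hj => by rw [Function.update_of_ne (Finset.ne_of_mem_erase hj)]]
  ring

/-- A profile of minimal social cost is a pure Nash equilibrium whenever every resource is paid
for exactly and no payment exceeds the marginal cost of the paying player. -/
theorem isPNE_of_socCost_le [Fintype ι] [Fintype E] [DecidableEq ι] [DecidableEq E]
    {conf : ι → Set (Finset E)} {d : ι → ℝ} {c : E → ℝ → ℝ} {S : ι → Finset E} {p : ι → E → ℝ}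
    (hS : ∀ i, S i ∈ conf i)
    (hmin : ∀ T : ι → Finset E, (∀ i, T i ∈ conf i) → socCost d c S ≤ socCost d c T)
    (hp : ∀ i e, 0 ≤ p i e) (hsum : ∀ e, ∑ i, p i e = c e (loadOf d S e))
    (hmarg : ∀ i e, p i e ≤
      c e (loadOf d S e) - c e (loadOf d S e - if e ∈ S i then d i else 0)) :
    IsPNE conf d c S p := by
  refine ⟨hS, hp, fun i S' p' hS' hp' => ?_⟩
  by_cases hb : ∀ e ∈ Function.update S i S' i,
      Bought d c (Function.update S i S') (Function.update p i p') e
  · have hdev : ∀ e, p i e - p' e ≤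
        c e (loadOf d S e) - c e (loadOf d (Function.update S i S') e) := fun e => by
      by_cases he : e ∈ S'
      · have h := hb e (by rwa [Function.update_self])
        rw [Bought, sum_update_payment, hsum] at h
        linarith
      · rw [loadOf_update_of_notMem d S i he]
        linarith [hmarg i e, hp' e]
    have htotal := Finset.sum_le_sum fun e (_ : e ∈ Finset.univ) => hdev e
    rw [Finset.sum_sub_distrib, Finset.sum_sub_distrib] at htotal
    have hopt := hmin (Function.update S i S') fun j => by
      rcases eq_or_ne j i with rfl | hj
      · rwa [Function.update_self]
      · rw [Function.update_of_ne hj]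
        exact hS j
    unfold socCost at hopt
    have hbought : ∀ e ∈ S i, Bought d c S p e := fun e _ => (hsum e).ge
    rw [privCost, privCost, if_pos hb, if_pos hbought, EReal.coe_le_coe_iff,
      Function.update_self]
    linarith
  · rw [privCost.eq_def _ _ (Function.update S i S'), if_neg hb]
    exact le_top

/-- Every weighted resource buying game all of whose (nondecreasing,
normalized) cost functions are marginally non-decreasing possesses a pure Nash
equilibrium, regardless of the structure of the configuration families. -/
theorem statement7 {ι E : Type*} [Fintype ι] [Fintype E] [DecidableEq ι] [DecidableEq E]
    (conf : ι → Set (Finset E)) (hconf : ∀ i, (conf i).Nonempty)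
    (d : ι → ℝ) (hd : ∀ i, 0 < d i) (c : E → ℝ → ℝ)
    (hmono : ∀ e, NondecrOn (c e)) (hzero : ∀ e, c e 0 = 0)
    (hnonneg : ∀ e, NonnegOn (c e)) (hMND : ∀ e, MargNondecr (c e)) :
    ∃ (S : ι → Finset E) (p : ι → E → ℝ), IsPNE conf d c S p := by
  obtain ⟨S, hS, hmin⟩ := Set.exists_min_image (Set.univ.pi conf) (socCost d c) (Set.toFinite _)
    (Set.univ_pi_nonempty_iff.2 hconf)
  have ha : ∀ e i, 0 ≤ if e ∈ S i then d i else 0 := fun e i => by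
    split_ifs
    exacts [(hd i).le, le_rfl]
  choose q hq hsum hmarg using fun e =>
    (hMND e).exists_cost_shares (hmono e) (hzero e) (ha e)
  simp only [← loadOf_eq_sum_ite] at hsum hmarg
  exact ⟨S, fun i e => q e i, isPNE_of_socCost_le (fun i => hS i (Set.mem_univ i))
    (fun T hT => hmin T fun i _ => hT i) (fun i e => hq e i) hsum fun i e => hmarg e i⟩

end
end
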